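/- Every IMM-consistent execution graph G is C11-consistent, where C11-consistency (for the fragment without non-atomic and SC accesses) requires: codom(rf) = R; for every location x, co totally orders the writes to x; hb_RC11;eco^? is irreflexive; rmw ∩ (fr_e;co_e) = ∅; and [F^sc];(hb_RC11 ∪ hb_RC11;eco;hb_RC11);[F^sc] is acyclic. -/

import Mathlib

/-! ## Basic definitions: events, labels, relations -/

abbrev Loc := ℕ
abbrev Val := ℕ

inductive Mode
  | rlx | acq | rel | acqrel | sc
deriving DecidableEq

inductive ExFlag
  | notex | ex
deriving DecidableEq

inductive Strength
  | normal | strong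
deriving DecidableEq

inductive Label
  | read (o : Mode) (x : Loc) (v : Val) (s : ExFlag)
  | write (o : Mode) (x : Loc) (v : Val) (st : Strength)
  | fence (o : Mode)
deriving DecidableEq

inductive Event
  | init (x : Loc)
  | ev (tid : ℕ) (sn : ℚ)
deriving DecidableEq

def Event.isInit : Event → Prop
  | .init _ => True
  | .ev _ _ => False

/-- the set of initialization events -/
def InitE : Set Event := {e | e.isInit}

/-- the `sequenced-before` partial order on events: initialization events precede all
non-initialization events, and events of the same thread are ordered by serial number -/
def evLt : Event → Event → Prop
  | .init _, .ev _ _ => True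
  | .ev i n, .ev j m => i = j ∧ n < m
  | _, _ => False

abbrev REv := Event → Event → Prop

/-- relational composition `r ; s` -/
def seqR (r s : REv) : REv := fun a c => ∃ b, r a b ∧ s b c

infixr:70 " ⬝ " => seqR

/-- identity relation on a set: `[A]` -/
def eqv (A : Set Event) : REv := fun a b => a = b ∧ a ∈ A

notation:max "⦗" A "⦘" => eqv A

/-- union of relations -/
def runion (r s : REv) : REv := fun a b => r a b ∨ s a b

infixl:65 " ∪ᵣ " => runion

/-- reflexive closure `r^?` -/
def rcl (r : REv) : REv := fun a b => a = b ∨ r a b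

/-- transitive closure `r⁺` -/
def tcl (r : REv) : REv := Relation.TransGen r

/-- reflexive-transitive closure `r*` -/
def rtcl (r : REv) : REv := Relation.ReflTransGen r

/-- inverse relation `r⁻¹` -/
def transp (r : REv) : REv := fun a b => r b a

def rdom (r : REv) : Set Event := {a | ∃ b, r a b}

def rcodom (r : REv) : Set Event := {b | ∃ a, r a b}

/-- immediate edges: `imm(r) = r ∖ r;r` -/
def immediate (r : REv) : REv := fun a b => r a b ∧ ¬ (r ⬝ r) a b

def acyclic (r : REv) : Prop := Irreflexive (tcl r)

/-- `r` totally orders `A` -/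
def totalOn (A : Set Event) (r : REv) : Prop :=
  ∀ a ∈ A, ∀ b ∈ A, a ≠ b → r a b ∨ r b a

def Label.locOf : Label → Option Loc
  | .read _ x _ _ => some x
  | .write _ x _ _ => some x
  | .fence _ => none

def Label.valOf : Label → Option Val
  | .read _ _ v _ => some v
  | .write _ _ v _ => some v
  | .fence _ => none

/-! ## IMM execution graphs -/

structure Execution where
  E : Set Event
  lab : Event → Label
  rmw : REv
  data : REv
  addr : REv
  ctrl : REv
  casdep : REv
  rf : REv
  co : REv

namespace Execution

variable (G : Execution)

def loc (e : Event) : Option Loc := (G.lab e).locOf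
def valu (e : Event) : Option Val := (G.lab e).valOf

/-- read events -/
def R : Set Event := {e | e ∈ G.E ∧ ∃ o x v s, G.lab e = .read o x v s}
/-- write events -/
def W : Set Event := {e | e ∈ G.E ∧ ∃ o x v st, G.lab e = .write o x v st}
/-- fence events -/
def F : Set Event := {e | e ∈ G.E ∧ ∃ o, G.lab e = .fence o}
/-- acquire reads -/
def Racq : Set Event := {e | e ∈ G.E ∧ ∃ x v s, G.lab e = .read .acq x v s}
/-- exclusive reads -/
def Rex : Set Event := {e | e ∈ G.E ∧ ∃ o x v, G.lab e = .read o x v .ex}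
/-- release writes -/
def Wrel : Set Event := {e | e ∈ G.E ∧ ∃ x v st, G.lab e = .write .rel x v st}
/-- strong writes -/
def Wstrong : Set Event := {e | e ∈ G.E ∧ ∃ o x v, G.lab e = .write o x v .strong}
/-- writes to location `x` -/
def Wloc (x : Loc) : Set Event := {e | e ∈ G.W ∧ G.loc e = some x}
/-- reads from location `x` -/
def Rloc (x : Loc) : Set Event := {e | e ∈ G.R ∧ G.loc e = some x}
/-- SC fences -/
def Fsc : Set Event := {e | e ∈ G.E ∧ G.lab e = .fence .sc}
/-- fences of mode exactly `rel` -/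
def Frel : Set Event := {e | e ∈ G.E ∧ G.lab e = .fence .rel}
/-- fences whose mode is at least `rel` (i.e. `rel`, `acqrel` or `sc`) -/
def FgeRel : Set Event :=
  {e | e ∈ G.E ∧ (G.lab e = .fence .rel ∨ G.lab e = .fence .acqrel ∨ G.lab e = .fence .sc)}
/-- fences whose mode is at least `acq` (i.e. `acq`, `acqrel` or `sc`) -/
def FgeAcq : Set Event :=
  {e | e ∈ G.E ∧ (G.lab e = .fence .acq ∨ G.lab e = .fence .acqrel ∨ G.lab e = .fence .sc)}

/-- program order -/
def po : REv := fun a b => a ∈ G.E ∧ b ∈ G.E ∧ evLt a b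

/-- both events access the same location -/
def sameLoc : REv := fun a b => ∃ x, G.loc a = some x ∧ G.loc b = some x

/-- `po|loc` -/
def poloc : REv := fun a b => G.po a b ∧ G.sameLoc a b

def rfi : REv := fun a b => G.rf a b ∧ G.po a b
def rfe : REv := fun a b => G.rf a b ∧ ¬ G.po a b
def coi : REv := fun a b => G.co a b ∧ G.po a b
def coe : REv := fun a b => G.co a b ∧ ¬ G.po a b

/-- from-read -/
def fr : REv := transp G.rf ⬝ G.co
def fri : REv := fun a b => G.fr a b ∧ G.po a b
def fre : REv := fun a b => G.fr a b ∧ ¬ G.po a b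

/-- release sequence -/
def rs : REv :=
  ⦗G.W⦘ ⬝ G.poloc ⬝ ⦗G.W⦘ ∪ᵣ ⦗G.W⦘ ⬝ rtcl (rcl G.poloc ⬝ G.rf ⬝ G.rmw)

/-- release prefix -/
def release : REv := (⦗G.Wrel⦘ ∪ᵣ ⦗G.FgeRel⦘ ⬝ G.po) ⬝ G.rs

/-- synchronizes with -/
def sw : REv :=
  G.release ⬝ (G.rfi ∪ᵣ rcl G.poloc ⬝ G.rfe) ⬝ (⦗G.Racq⦘ ∪ᵣ G.po ⬝ ⦗G.FgeAcq⦘)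

/-- happens-before -/
def hb : REv := tcl (G.po ∪ᵣ G.sw)

/-- extended coherence order -/
def eco : REv := G.rf ∪ᵣ G.co ⬝ rcl G.rf ∪ᵣ G.fr ⬝ rcl G.rf

/-- barrier order -/
def bob : REv :=
  G.po ⬝ ⦗G.Wrel⦘ ∪ᵣ ⦗G.Racq⦘ ⬝ G.po ∪ᵣ G.po ⬝ ⦗G.F⦘ ∪ᵣ ⦗G.F⦘ ⬝ G.po ∪ᵣ
    ⦗G.Wrel⦘ ⬝ G.poloc ⬝ ⦗G.W⦘

/-- syntactic dependencies -/
def deps : REv :=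
  G.data ∪ᵣ G.ctrl ∪ᵣ G.addr ⬝ rcl G.po ∪ᵣ G.casdep ∪ᵣ ⦗G.Rex⦘ ⬝ G.po

/-- preserved program order -/
def ppo : REv := ⦗G.R⦘ ⬝ tcl (G.deps ∪ᵣ G.rfi) ⬝ ⦗G.W⦘

def detour : REv := fun a b => (G.coe ⬝ G.rfe) a b ∧ G.po a b

/-- partial SC fence order -/
def psc : REv := ⦗G.Fsc⦘ ⬝ G.hb ⬝ G.eco ⬝ G.hb ⬝ ⦗G.Fsc⦘

/-- the acyclicity relation of IMM -/
def ar : REv :=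
  G.rfe ∪ᵣ G.bob ∪ᵣ G.ppo ∪ᵣ G.detour ∪ᵣ G.psc ∪ᵣ ⦗G.Wstrong⦘ ⬝ G.po ⬝ ⦗G.W⦘

/-! RC11-style variants -/

def rsRC11 : REv := ⦗G.W⦘ ⬝ rcl G.poloc ⬝ rtcl (G.rf ⬝ G.rmw)

def releaseRC11 : REv := (⦗G.Wrel⦘ ∪ᵣ ⦗G.FgeRel⦘ ⬝ G.po) ⬝ G.rsRC11

def swRC11 : REv := G.releaseRC11 ⬝ G.rf ⬝ (⦗G.Racq⦘ ∪ᵣ G.po ⬝ ⦗G.FgeAcq⦘)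

def hbRC11 : REv := tcl (G.po ∪ᵣ G.swRC11)

end Execution

/-- Well-formedness of an IMM execution graph -/
structure ExecWf (G : Execution) : Prop where
  finE : G.E.Finite
  init_lab : ∀ x, Event.init x ∈ G.E →
    G.lab (Event.init x) = Label.write .rlx x 0 .normal
  read_mode : ∀ e ∈ G.E, ∀ o x v s, G.lab e = .read o x v s → o = Mode.rlx ∨ o = Mode.acq
  write_mode : ∀ e ∈ G.E, ∀ o x v st, G.lab e = .write o x v st → o = Mode.rlx ∨ o = Mode.rel
  fence_mode : ∀ e ∈ G.E, ∀ o, G.lab e = .fence o →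
    o = Mode.acq ∨ o = Mode.rel ∨ o = Mode.acqrel ∨ o = Mode.sc
  rmw_sub : ∀ a b, G.rmw a b → a ∈ G.Rex ∧ b ∈ G.W ∧ G.sameLoc a b ∧ immediate G.po a b
  strong_rmw : G.Wstrong ⊆ rcodom G.rmw
  data_sub : ∀ a b, G.data a b → a ∈ G.R ∧ G.po a b ∧ b ∈ G.W
  addr_sub : ∀ a b, G.addr a b → a ∈ G.R ∧ G.po a b ∧ (b ∈ G.R ∨ b ∈ G.W)
  ctrl_sub : ∀ a b, G.ctrl a b → a ∈ G.R ∧ G.po a b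
  ctrl_po : ∀ a b c, G.ctrl a b → G.po b c → G.ctrl a c
  casdep_sub : ∀ a b, G.casdep a b → a ∈ G.R ∧ G.po a b ∧ b ∈ G.Rex
  rf_sub : ∀ a b, G.rf a b → a ∈ G.W ∧ b ∈ G.R ∧ G.sameLoc a b
  rf_val : ∀ a b, G.rf a b → G.valu a = G.valu b
  rf_func : ∀ a b c, G.rf a c → G.rf b c → a = b
  co_sub : ∀ a b, G.co a b → a ∈ G.W ∧ b ∈ G.W ∧ G.sameLoc a b
  co_trans : Transitive G.co
  co_irr : Irreflexive G.co

/-- IMM-consistency (Definition 3.1) -/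
def IMMConsistent (G : Execution) : Prop :=
  rcodom G.rf = G.R ∧
  (∀ x, totalOn (G.Wloc x) G.co) ∧
  Irreflexive (G.hb ⬝ rcl G.eco) ∧
  (∀ a b, G.rmw a b → ¬ (G.fre ⬝ G.coe) a b) ∧
  acyclic G.ar

/-- C11-consistency (for the fragment without non-atomic and SC accesses). -/
def C11Consistent (G : Execution) : Prop :=
  rcodom G.rf = G.R ∧
  (∀ x, totalOn (G.Wloc x) G.co) ∧
  Irreflexive (G.hbRC11 ⬝ rcl G.eco) ∧
  (∀ a b, G.rmw a b → ¬ (G.fre ⬝ G.coe) a b) ∧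
  acyclic (⦗G.Fsc⦘ ⬝ (G.hbRC11 ∪ᵣ G.hbRC11 ⬝ G.eco ⬝ G.hbRC11) ⬝ ⦗G.Fsc⦘)

open Relation

namespace Execution

variable {G : Execution}

theorem po_trans {a b c : Event} (hab : G.po a b) (hbc : G.po b c) : G.po a c := by
  obtain ⟨ha, -, hlt⟩ := hab
  obtain ⟨-, hc, hlt'⟩ := hbc
  refine ⟨ha, hc, ?_⟩
  cases a <;> cases b <;> cases c <;> simp only [evLt] at hlt hlt' ⊢
  exact ⟨hlt.1.trans hlt'.1, hlt.2.trans hlt'.2⟩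

theorem rcl_po_trans {a b c : Event} (hab : rcl G.po a b) (hbc : rcl G.po b c) :
    rcl G.po a c := by
  rcases hab with rfl | hab
  · exact hbc
  · rcases hbc with rfl | hbc
    · exact .inr hab
    · exact .inr (po_trans hab hbc)

theorem sameLoc_trans {a b c : Event} (hab : G.sameLoc a b) (hbc : G.sameLoc b c) :
    G.sameLoc a c := by
  obtain ⟨x, ha, hb⟩ := hab
  obtain ⟨y, hb', hc⟩ := hbc
  exact ⟨x, ha, by rw [hc, ← hb', hb]⟩

theorem rcl_poloc_trans {a b c : Event} (hab : rcl G.poloc a b) (hbc : rcl G.poloc b c) :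
    rcl G.poloc a c := by
  rcases hab with rfl | hab
  · exact hbc
  · rcases hbc with rfl | hbc
    · exact .inr hab
    · exact .inr ⟨po_trans hab.1 hbc.1, sameLoc_trans hab.2 hbc.2⟩

theorem rcl_po_of_rcl_poloc {a b : Event} (h : rcl G.poloc a b) : rcl G.po a b :=
  h.imp id And.left

theorem Rex_subset_R : G.Rex ⊆ G.R :=
  fun _ ⟨he, o, x, v, h⟩ => ⟨he, o, x, v, .ex, h⟩

theorem FgeRel_subset_F : G.FgeRel ⊆ G.F := by
  rintro e ⟨he, h | h | h⟩ <;> exact ⟨he, _, h⟩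

theorem Fsc_subset_F : G.Fsc ⊆ G.F :=
  fun _ ⟨he, h⟩ => ⟨he, _, h⟩

theorem ar_of_rfe {a b : Event} (h : G.rfe a b) : G.ar a b :=
  .inl <| .inl <| .inl <| .inl <| .inl h

theorem ar_of_bob {a b : Event} (h : G.bob a b) : G.ar a b :=
  .inl <| .inl <| .inl <| .inl <| .inr h

theorem ar_of_psc {a b : Event} (h : G.psc a b) : G.ar a b :=
  .inl <| .inr h

theorem ar_of_po_of_Wrel {a b : Event} (h : G.po a b) (hb : b ∈ G.Wrel) : G.ar a b :=
  ar_of_bob <| .inl <| .inl <| .inl <| .inl ⟨b, h, rfl, hb⟩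

theorem ar_of_po_of_F {a b : Event} (h : G.po a b) (hb : b ∈ G.F) : G.ar a b :=
  ar_of_bob <| .inl <| .inl <| .inr ⟨b, h, rfl, hb⟩

theorem ar_of_F_of_po {a b : Event} (ha : a ∈ G.F) (h : G.po a b) : G.ar a b :=
  ar_of_bob <| .inl <| .inr ⟨a, ⟨rfl, ha⟩, h⟩

theorem ar_of_Wrel_of_poloc {a b : Event} (ha : a ∈ G.Wrel) (h : G.poloc a b)
    (hb : b ∈ G.W) : G.ar a b :=
  ar_of_bob <| .inr ⟨a, ⟨rfl, ha⟩, b, h, rfl, hb⟩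

theorem ar_of_Rex_of_po {a b : Event} (ha : a ∈ G.Rex) (h : G.po a b) (hb : b ∈ G.W) :
    G.ar a b :=
  .inl <| .inl <| .inl <| .inr
    ⟨a, ⟨rfl, Rex_subset_R ha⟩, b, .single (.inl (.inr ⟨a, ⟨rfl, ha⟩, h⟩)), rfl, hb⟩

/-- `b` is reachable from `a` by `ar` steps followed by at most one `po` step. -/
def ArPo (G : Execution) (a b : Event) : Prop :=
  ∃ c, ReflTransGen G.ar a c ∧ rcl G.po c b

theorem ArPo.po_right {a b c : Event} (h : G.ArPo a b) (hbc : rcl G.po b c) : G.ArPo a c :=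
  let ⟨d, had, hdb⟩ := h
  ⟨d, had, rcl_po_trans hdb hbc⟩

theorem ArPo.reflTransGen_ar {a b : Event} (h : G.ArPo a b) (hb : b ∈ G.Wrel ∨ b ∈ G.F) :
    ReflTransGen G.ar a b := by
  obtain ⟨c, hac, rfl | hcb⟩ := h
  · exact hac
  · exact hac.tail (hb.elim (ar_of_po_of_Wrel hcb) (ar_of_po_of_F hcb))

/-- `w` lies on a release sequence of `a`: it is reachable through `ar` and `po`, and all writes
to its location that follow it in its thread are reachable through `ar` alone. -/
def ArRelease (G : Execution) (a w : Event) : Prop :=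
  G.ArPo a w ∧ ∀ w' ∈ G.W, rcl G.poloc w w' → ReflTransGen G.ar a w'

theorem ArRelease.poloc_right {a w w' : Event} (h : G.ArRelease a w)
    (hw : rcl G.poloc w w') : G.ArRelease a w' :=
  ⟨h.1.po_right (rcl_po_of_rcl_poloc hw), fun w'' hW hw' => h.2 w'' hW (rcl_poloc_trans hw hw')⟩

theorem ArRelease.of_Wrel {w : Event} (hw : w ∈ G.Wrel) : G.ArRelease w w := by
  refine ⟨⟨w, .refl, .inl rfl⟩, ?_⟩
  rintro w' hW (rfl | h)
  · exact .refl
  · exact .single (ar_of_Wrel_of_poloc hw h hW)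

theorem ArRelease.of_F {f w : Event} (hf : f ∈ G.F) (h : G.po f w) : G.ArRelease f w := by
  refine ⟨⟨f, .refl, .inr h⟩, ?_⟩
  rintro w' - (rfl | h')
  · exact .single (ar_of_F_of_po hf h)
  · exact .single (ar_of_F_of_po hf (po_trans h h'.1))

theorem ArRelease.rf_rmw {a w r w' : Event} (hwf : ExecWf G) (h : G.ArRelease a w)
    (hrf : G.rf w r) (hrmw : G.rmw r w') : G.ArRelease a w' := by
  obtain ⟨hW, -, hloc⟩ := hwf.rf_sub _ _ hrf
  obtain ⟨hRex, hW', hloc', hpo, -⟩ := hwf.rmw_sub _ _ hrmw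
  by_cases hi : G.po w r
  · exact h.poloc_right (rcl_poloc_trans (.inr ⟨hi, hloc⟩) (.inr ⟨hpo, hloc'⟩))
  · have har : ReflTransGen G.ar a r := (h.2 w hW (.inl rfl)).tail (ar_of_rfe ⟨hrf, hi⟩)
    refine ⟨⟨r, har, .inr hpo⟩, ?_⟩
    rintro w'' hW'' (rfl | hpo')
    · exact har.tail (ar_of_Rex_of_po hRex hpo hW')
    · exact har.tail (ar_of_Rex_of_po hRex (po_trans hpo hpo'.1) hW'')

theorem ArRelease.rs {a w w' : Event} (hwf : ExecWf G) (h : G.ArRelease a w)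
    (hrs : G.rs w w') : G.ArRelease a w' := by
  rcases hrs with ⟨_, ⟨rfl, -⟩, _, hpo, rfl, -⟩ | ⟨_, ⟨rfl, -⟩, hrs⟩
  · exact h.poloc_right (.inr hpo)
  · induction hrs with
    | refl => exact h
    | tail _ hstep ih =>
      obtain ⟨_, hpo, _, hrf, hrmw⟩ := hstep
      exact (ih.poloc_right hpo).rf_rmw hwf hrf hrmw

theorem arRelease_of_release {a w : Event} (hwf : ExecWf G) (h : G.release a w) :
    G.ArRelease a w := by
  obtain ⟨_, ⟨rfl, ha⟩ | ⟨_, ⟨rfl, ha⟩, hpo⟩, hrs⟩ := h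
  · exact (ArRelease.of_Wrel ha).rs hwf hrs
  · exact (ArRelease.of_F (FgeRel_subset_F ha) hpo).rs hwf hrs

theorem Wrel_or_F_of_release {a w : Event} (h : G.release a w) : a ∈ G.Wrel ∨ a ∈ G.F := by
  obtain ⟨_, ⟨rfl, ha⟩ | ⟨_, ⟨rfl, ha⟩, -⟩, -⟩ := h
  · exact .inl ha
  · exact .inr (FgeRel_subset_F ha)

theorem arPo_of_sw {a b : Event} (hwf : ExecWf G) (h : G.sw a b) : G.ArPo a b := by
  obtain ⟨w, hrel, r, hrf, hacq⟩ := h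
  have hw := arRelease_of_release hwf hrel
  have hrb : rcl G.po r b := by
    rcases hacq with ⟨rfl, -⟩ | ⟨_, hpo, rfl, -⟩
    · exact .inl rfl
    · exact .inr hpo
  rcases hrf with hrfi | ⟨w', hpo, hrfe⟩
  · exact (hw.1.po_right (.inr hrfi.2)).po_right hrb
  · exact ⟨r, (hw.2 w' (hwf.rf_sub _ _ hrfe.1).1 hpo).tail (ar_of_rfe hrfe), hrb⟩

theorem arPo_of_hb {a b : Event} (hwf : ExecWf G) (h : G.hb a b) : G.ArPo a b := by
  have step : ∀ {b c}, G.ArPo a b → (G.po ∪ᵣ G.sw) b c → G.ArPo a c := by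
    rintro b c hab (hpo | hsw)
    · exact hab.po_right (.inr hpo)
    · obtain ⟨d, hbd, hdc⟩ := arPo_of_sw hwf hsw
      obtain ⟨_, hrel, -⟩ := hsw
      exact ⟨d, (hab.reflTransGen_ar (Wrel_or_F_of_release hrel)).trans hbd, hdc⟩
  induction h with
  | single h => exact step ⟨a, .refl, .inl rfl⟩ h
  | tail _ h ih => exact step ih h

theorem sw_of_swRC11 {a b : Event} (hwf : ExecWf G) (h : G.swRC11 a b) : G.sw a b := by
  obtain ⟨w, ⟨w₀, hrel, _, ⟨rfl, hW₀⟩, w₁, hpo, hchain⟩, r, hrf, hacq⟩ := h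
  have hW := (hwf.rf_sub _ _ hrf).1
  rcases hchain.cases_head with rfl | ⟨w₂, ⟨r₁, hrf₁, hrmw⟩, hchain⟩
  · by_cases hi : G.po w₁ r
    · refine ⟨w₁, ⟨w₀, hrel, ?_⟩, r, .inl ⟨hrf, hi⟩, hacq⟩
      rcases hpo with rfl | hpo
      · exact .inr ⟨w₀, ⟨rfl, hW₀⟩, .refl⟩
      · exact .inl ⟨w₀, ⟨rfl, hW₀⟩, w₁, hpo, rfl, hW⟩
    · exact ⟨w₀, ⟨w₀, hrel, .inr ⟨w₀, ⟨rfl, hW₀⟩, .refl⟩⟩, r, .inr ⟨w₁, hpo, hrf, hi⟩, hacq⟩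
  · have hrs : G.rs w₀ w := .inr ⟨w₀, ⟨rfl, hW₀⟩,
      .head ⟨w₁, hpo, r₁, hrf₁, hrmw⟩
        (ReflTransGen.mono (fun x _ ⟨y, hxy, hyz⟩ => ⟨x, .inl rfl, y, hxy, hyz⟩) _ _ hchain)⟩
    refine ⟨w, ⟨w₀, hrel, hrs⟩, r, ?_, hacq⟩
    by_cases hi : G.po w r
    · exact .inl ⟨hrf, hi⟩
    · exact .inr ⟨w, .inl rfl, hrf, hi⟩

theorem hb_of_hbRC11 {a b : Event} (hwf : ExecWf G) (h : G.hbRC11 a b) : G.hb a b :=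
  TransGen.mono (fun _ _ h => h.imp id (sw_of_swRC11 hwf)) _ _ h

theorem transGen_ar_of_hb {a b : Event} (hwf : ExecWf G)
    (hcoh : Irreflexive (G.hb ⬝ rcl G.eco)) (h : G.hb a b) (hb : b ∈ G.F) :
    TransGen G.ar a b := by
  rcases reflTransGen_iff_eq_or_transGen.1 ((arPo_of_hb hwf h).reflTransGen_ar (.inr hb)) with
    rfl | har
  · exact absurd ⟨_, h, .inl rfl⟩ (hcoh _)
  · exact har

end Execution

open Execution in
/-- every IMM-consistent execution graph is C11-consistent. -/
theorem imm_consistent_implies_c11_consistent (G : Execution) (hwf : ExecWf G) :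
    IMMConsistent G → C11Consistent G := by
  rintro ⟨hrf, hco, hcoh, hat, hacyc⟩
  refine ⟨hrf, hco, ?_, hat, ?_⟩
  · rintro a ⟨b, hab, hba⟩
    exact hcoh a ⟨b, hb_of_hbRC11 hwf hab, hba⟩
  · intro a ha
    refine hacyc a (TransGen.closed ?_ _ _ ha)
    rintro x y ⟨_, ⟨rfl, hx⟩, _, hxy, rfl, hy⟩
    rcases hxy with hhb | ⟨u, hxu, v, huv, hvy⟩
    · exact transGen_ar_of_hb hwf hcoh (hb_of_hbRC11 hwf hhb) (Fsc_subset_F hy)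
    · exact .single (ar_of_psc ⟨x, ⟨rfl, hx⟩, u, hb_of_hbRC11 hwf hxu, v, huv, _,
        hb_of_hbRC11 hwf hvy, rfl, hy⟩)
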